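/- Let 0 < α < β < 1. Then ν({(x,ω) ∈ Δ₀ : R(x,ω) > n}) is asymptotically equivalent, as n → ∞, to A n^{-1/α}, where A = (1/4)(α p₁)^{-1/α} ∫₀¹ h(1/2,ω) dω; that is, the ratio of the two quantities tends to 1. -/

import Mathlib

open MeasureTheory Filter Set Topology

noncomputable section

/-- The Liverani–Saussol–Vaienti map `T_a` on `[0,1]`. -/
def lsv (a x : ℝ) : ℝ := if x ≤ 1 / 2 then x * (1 + (2 : ℝ) ^ a * x ^ a) else 2 * x - 1

/-- Random parameter selection: `α` on `[0,p₁)`, `β` on `[p₁,1]`. -/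
def alphaOf (α β p₁ ω : ℝ) : ℝ := if ω < p₁ then α else β

/-- The noise dynamics `φ` on `[0,1]`. -/
def phiMap (p₁ ω : ℝ) : ℝ := if ω < p₁ then ω / p₁ else (ω - p₁) / (1 - p₁)

/-- The skew product `S(x,ω) = (T_{α(ω)} x, φ ω)`. -/
def skewLSV (α β p₁ : ℝ) (p : ℝ × ℝ) : ℝ × ℝ :=
  (lsv (alphaOf α β p₁ p.2) p.1, phiMap p₁ p.2)

/-- The base of inducing, `Δ₀ = (1/2,1] × [0,1]`. -/
def Δ0 : Set (ℝ × ℝ) := Ioc (1 / 2 : ℝ) 1 ×ˢ Icc (0 : ℝ) 1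

/-- First return time of the skew product `S` to `Δ₀`. -/
def retTime (α β p₁ : ℝ) (p : ℝ × ℝ) : ℕ :=
  sInf {n : ℕ | 1 ≤ n ∧ (skewLSV α β p₁)^[n] p ∈ Δ0}

/-- The constant `A = (1/4)(α p₁)^{-1/α} ∫₀¹ h(1/2,ω) dω`. -/
def Aconst (α p₁ : ℝ) (h : ℝ × ℝ → ℝ) : ℝ :=
  (1 / 4 : ℝ) * (α * p₁) ^ (-(1 / α)) * ∫ ω in Icc (0 : ℝ) 1, h (1 / 2, ω)

/-! ### The left branch of the LSV map -/

lemma lsv_of_le {a x : ℝ} (hx : x ≤ 1 / 2) : lsv a x = x * (1 + (2 : ℝ) ^ a * x ^ a) := if_pos hx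

lemma lsv_of_lt {a x : ℝ} (hx : 1 / 2 < x) : lsv a x = 2 * x - 1 := if_neg hx.not_ge

lemma lsv_eq_two_mul {a x : ℝ} (h0 : 0 ≤ x) (hx : x ≤ 1 / 2) :
    lsv a x = x * (1 + (2 * x) ^ a) := by
  rw [lsv_of_le hx, Real.mul_rpow zero_le_two h0]

lemma lsv_mem_Ioc {a x : ℝ} (ha : 0 < a) (hx : x ∈ Ioc (0 : ℝ) 1) : lsv a x ∈ Ioc (0 : ℝ) 1 := by
  obtain ⟨h0, h1⟩ := hx
  rcases le_or_gt x (1 / 2) with h | h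
  · rw [lsv_eq_two_mul h0.le h]
    have h2 : (2 * x) ^ a ≤ 1 := Real.rpow_le_one (by linarith) (by linarith) ha.le
    have h3 : 0 < (2 * x) ^ a := Real.rpow_pos_of_pos (by linarith) a
    exact ⟨by positivity, by nlinarith⟩
  · rw [lsv_of_lt h]
    constructor <;> linarith

lemma mul_le_lsv {a b δ x : ℝ} (hab : a ≤ b) (hδ : 0 < δ) (hb : 0 ≤ b) (hδx : δ ≤ x)
    (hx : x ≤ 1 / 2) : x * (1 + (2 * δ) ^ b) ≤ lsv a x := by
  rw [lsv_eq_two_mul (by linarith) hx]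
  have h1 : (2 * δ) ^ b ≤ (2 * x) ^ b := Real.rpow_le_rpow (by linarith) (by linarith) hb
  have h2 : (2 * x) ^ b ≤ (2 * x) ^ a :=
    Real.rpow_le_rpow_of_exponent_ge (by linarith) (by linarith) hab
  have : 0 < x := by linarith
  gcongr
  exact h1.trans h2

lemma le_lsv {a x : ℝ} (h0 : 0 < x) (hx : x ≤ 1 / 2) : x ≤ lsv a x := by
  rw [lsv_eq_two_mul h0.le hx]
  have : 0 < (2 * x) ^ a := Real.rpow_pos_of_pos (by linarith) a
  nlinarith

/-- One step of the left branch lowers `x ^ (-c)` by at most `c * 2 ^ a * x ^ (a - c)`. -/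
lemma rpow_neg_sub_le_lsv {a c x : ℝ} (hc : 0 < c) (hc1 : c ≤ 1) (h0 : 0 < x) (hx : x ≤ 1 / 2) :
    x ^ (-c) - c * 2 ^ a * x ^ (a - c) ≤ lsv a x ^ (-c) := by
  rw [lsv_of_le hx]
  have h2a : 0 < (2 : ℝ) ^ a := by positivity
  have hxa : 0 < x ^ a := by positivity
  have hs : 0 < (2 : ℝ) ^ a * x ^ a := by positivity
  set s := (2 : ℝ) ^ a * x ^ a with hsdef
  rw [Real.mul_rpow h0.le (by positivity), Real.rpow_sub h0, Real.rpow_neg (by positivity : 0 ≤ 1 + s)]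
  have h1 : (1 + s) ^ c ≤ 1 + c * s := rpow_one_add_le_one_add_mul_self (by linarith) hc.le hc1
  have h2 : 1 - c * s ≤ ((1 + s) ^ c)⁻¹ := by
    have h3 : (1 + c * s)⁻¹ ≤ ((1 + s) ^ c)⁻¹ := inv_anti₀ (by positivity) h1
    refine le_trans ?_ h3
    rw [← one_div, le_div_iff₀ (by positivity)]
    nlinarith [sq_nonneg (c * s)]
  have h4 : 0 < x ^ (-c) := by positivity
  calc x ^ (-c) - c * 2 ^ a * (x ^ a / x ^ c) = x ^ (-c) * (1 - c * s) := by
        rw [Real.rpow_neg h0.le, hsdef]; field_simp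
    _ ≤ _ := by gcongr

/-- A Lyapunov function for the left branch. -/
def potential (c x : ℝ) : ℝ := x ^ (-c) - 8 * Real.log x

lemma potential_anti {c x y : ℝ} (hc : 0 < c) (h0 : 0 < x) (hxy : x ≤ y) :
    potential c y ≤ potential c x := by
  have h1 : y ^ (-c) ≤ x ^ (-c) := Real.rpow_le_rpow_of_nonpos h0 hxy (by linarith)
  have h2 : Real.log x ≤ Real.log y := Real.log_le_log h0 hxy
  unfold potential
  linarith

lemma potential_nonneg {c x : ℝ} (h0 : 0 < x) (hx : x ≤ 1) : 0 ≤ potential c x := by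
  have h1 : 0 < x ^ (-c) := by positivity
  have h2 : Real.log x ≤ 0 := Real.log_nonpos h0.le hx
  unfold potential
  linarith

lemma potential_lsv_le {c x : ℝ} (hc : 0 < c) (hc1 : c ≤ 1) (h0 : 0 < x) (hx : x ≤ 1 / 2) :
    potential c (lsv c x) ≤ potential c x - c * 2 ^ c := by
  have hs1 : (2 * x) ^ c ≤ 1 := Real.rpow_le_one (by linarith) (by linarith) hc.le
  have hs0 : 0 < (2 * x) ^ c := Real.rpow_pos_of_pos (by linarith) c
  have hsx : (2 * x) ^ c = 2 ^ c * x ^ c := Real.mul_rpow zero_le_two h0.le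
  rw [lsv_eq_two_mul h0.le hx]
  unfold potential
  rw [Real.mul_rpow h0.le (by positivity), Real.log_mul h0.ne' (by positivity),
    Real.rpow_neg h0.le, Real.rpow_neg (by positivity : 0 ≤ 1 + (2 * x) ^ c)]
  have h2c : (2 : ℝ) ^ c ≤ 2 := by
    simpa using Real.rpow_le_rpow_of_exponent_le (one_le_two : (1 : ℝ) ≤ 2) hc1
  have h2c0 : 0 < (2 : ℝ) ^ c := by positivity
  have hxc : 0 < x ^ c := by positivity
  set s := (2 * x) ^ c with hs
  set l := Real.log (1 + s) with hl
  have hls : l ≤ s := by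
    have := Real.log_le_sub_one_of_pos (by linarith : 0 < 1 + s); linarith
  have hsl : s - s ^ 2 ≤ l := by
    have h := Real.one_sub_inv_le_log_of_pos (by linarith : 0 < 1 + s)
    refine le_trans ?_ h
    rw [← sub_nonneg]
    have : 1 - (1 + s)⁻¹ - (s - s ^ 2) = s ^ 3 / (1 + s) := by field_simp; ring
    rw [this]; positivity
  have hsl2 : s / 2 ≤ l := by
    have h := Real.one_sub_inv_le_log_of_pos (by linarith : 0 < 1 + s)
    refine le_trans ?_ h
    rw [← sub_nonneg]
    have : 1 - (1 + s)⁻¹ - s / 2 = s * (1 - s) / (2 * (1 + s)) := by field_simp; ring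
    rw [this]
    have : 0 ≤ 1 - s := by linarith
    positivity
  have hl0 : 0 < l := by linarith
  have hw : 1 + c * l ≤ (1 + s) ^ c := by
    rw [Real.rpow_def_of_pos (by linarith)]
    have := Real.add_one_le_exp (Real.log (1 + s) * c)
    linarith
  have hwi : ((1 + s) ^ c)⁻¹ ≤ 1 - c * s + 2 * s ^ 2 := by
    have h3 : ((1 + s) ^ c)⁻¹ ≤ (1 + c * l)⁻¹ := inv_anti₀ (by positivity) hw
    have h4 : (1 + c * l)⁻¹ ≤ 1 - c * l + (c * l) ^ 2 := by
      rw [← sub_nonneg]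
      have : 1 - c * l + (c * l) ^ 2 - (1 + c * l)⁻¹ = (c * l) ^ 3 / (1 + c * l) := by
        field_simp; ring
      rw [this]; positivity
    have h5 : c * (s - s ^ 2) ≤ c * l := by gcongr
    have h6 : c * l ≤ s := by nlinarith
    have h7 : (c * l) ^ 2 ≤ s ^ 2 := by gcongr
    have h8 : c * s ^ 2 ≤ s ^ 2 := by nlinarith [sq_nonneg s]
    linarith
  have hz : (x ^ c)⁻¹ = 2 ^ c / s := by rw [hsx]; field_simp
  rw [hz]
  have h9 : 2 ^ c / s * ((1 + s) ^ c)⁻¹ ≤ 2 ^ c / s * (1 - c * s + 2 * s ^ 2) := by gcongr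
  have h10 : 2 ^ c / s * (1 - c * s + 2 * s ^ 2) = 2 ^ c / s - c * 2 ^ c + 2 * 2 ^ c * s := by
    field_simp
  nlinarith

/-! ### Orbits of the skew product -/

lemma phiMap_mem_Icc {p₁ ω : ℝ} (hp₁ : 0 < p₁) (hp₁' : p₁ < 1) (hω : ω ∈ Icc (0 : ℝ) 1) :
    phiMap p₁ ω ∈ Icc (0 : ℝ) 1 := by
  obtain ⟨h0, h1⟩ := hω
  have hq : 0 < 1 - p₁ := by linarith
  unfold phiMap
  split_ifs with h
  · exact ⟨by positivity, (div_le_one hp₁).2 h.le⟩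
  · push Not at h
    exact ⟨div_nonneg (by linarith) hq.le, (div_le_one hq).2 (by linarith)⟩

lemma alphaOf_mem {α β p₁ ω : ℝ} (hαβ : α < β) : alphaOf α β p₁ ω ∈ Icc α β := by
  unfold alphaOf
  split_ifs
  exacts [⟨le_rfl, hαβ.le⟩, ⟨hαβ.le, le_rfl⟩]

lemma skewLSV_iterate_snd (α β p₁ : ℝ) (k : ℕ) (p : ℝ × ℝ) :
    ((skewLSV α β p₁)^[k] p).2 = (phiMap p₁)^[k] p.2 := by
  induction k with
  | zero => rfl
  | succ k ih => rw [Function.iterate_succ_apply', Function.iterate_succ_apply', ← ih]; rfl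

lemma skewLSV_iterate_succ_fst (α β p₁ : ℝ) (k : ℕ) (p : ℝ × ℝ) :
    ((skewLSV α β p₁)^[k + 1] p).1 =
      lsv (alphaOf α β p₁ ((phiMap p₁)^[k] p.2)) ((skewLSV α β p₁)^[k] p).1 := by
  rw [Function.iterate_succ_apply', ← skewLSV_iterate_snd α β]; rfl

lemma skewLSV_iterate_mem {α β p₁ : ℝ} (hα : 0 < α) (hαβ : α < β) (hp₁ : 0 < p₁) (hp₁' : p₁ < 1)
    {p : ℝ × ℝ} (hp : p ∈ Δ0) (k : ℕ) :
    (skewLSV α β p₁)^[k] p ∈ Ioc (0 : ℝ) 1 ×ˢ Icc (0 : ℝ) 1 := by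
  induction k with
  | zero => exact ⟨⟨lt_trans (by norm_num) hp.1.1, hp.1.2⟩, hp.2⟩
  | succ k ih =>
    rw [Function.iterate_succ_apply']
    exact ⟨lsv_mem_Ioc (hα.trans_le (alphaOf_mem hαβ).1) ih.1, phiMap_mem_Icc hp₁ hp₁' ih.2⟩

lemma skewLSV_iterate_one_fst {α β p₁ : ℝ} {p : ℝ × ℝ} (hp : p ∈ Δ0) :
    ((skewLSV α β p₁)^[1] p).1 = 2 * p.1 - 1 := lsv_of_lt hp.1.1

lemma fst_le_of_lt_retTime {α β p₁ : ℝ} (hα : 0 < α) (hαβ : α < β) (hp₁ : 0 < p₁) (hp₁' : p₁ < 1)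
    {p : ℝ × ℝ} (hp : p ∈ Δ0) {k : ℕ} (hk : 1 ≤ k) (hkR : k < retTime α β p₁ p) :
    ((skewLSV α β p₁)^[k] p).1 ≤ 1 / 2 := by
  have h1 := Nat.notMem_of_lt_sInf hkR
  have h2 := skewLSV_iterate_mem hα hαβ hp₁ hp₁' hp k
  by_contra! h3
  exact h1 ⟨hk, ⟨h3, h2.1.2⟩, h2.2⟩

/-- Orbits grow by a fixed factor as long as they stay in the left half, so they leave it. -/
lemma exists_return {α β p₁ : ℝ} (hα : 0 < α) (hαβ : α < β) (hp₁ : 0 < p₁) (hp₁' : p₁ < 1)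
    {p : ℝ × ℝ} (hp : p ∈ Δ0) : ∃ k, 1 ≤ k ∧ (skewLSV α β p₁)^[k] p ∈ Δ0 := by
  by_contra! hno
  have hle : ∀ k, 1 ≤ k → ((skewLSV α β p₁)^[k] p).1 ≤ 1 / 2 := by
    intro k hk
    have h2 := skewLSV_iterate_mem hα hαβ hp₁ hp₁' hp k
    by_contra! h3
    exact hno k hk ⟨⟨h3, h2.1.2⟩, h2.2⟩
  set δ := ((skewLSV α β p₁)^[1] p).1 with hδdef
  have hδ : 0 < δ := (skewLSV_iterate_mem hα hαβ hp₁ hp₁' hp 1).1.1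
  have hκ : 1 < 1 + (2 * δ) ^ β := by
    have : 0 < (2 * δ) ^ β := Real.rpow_pos_of_pos (by linarith) β
    linarith
  have hgrow : ∀ k, δ * (1 + (2 * δ) ^ β) ^ k ≤ ((skewLSV α β p₁)^[k + 1] p).1 := by
    intro k
    induction k with
    | zero => simp [hδdef]
    | succ k ih =>
      have h1 : δ ≤ ((skewLSV α β p₁)^[k + 1] p).1 :=
        le_trans (le_mul_of_one_le_right hδ.le (one_le_pow₀ hκ.le)) ih
      rw [skewLSV_iterate_succ_fst, pow_succ, ← mul_assoc]
      refine le_trans ?_ (mul_le_lsv (alphaOf_mem hαβ).2 hδ (hα.trans hαβ).le h1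
        (hle _ (by omega)))
      gcongr
  obtain ⟨k, hk⟩ := pow_unbounded_of_one_lt (1 / δ) hκ
  have h1 := hgrow k
  have h2 := hle (k + 1) (by omega)
  rw [div_lt_iff₀ hδ] at hk
  linarith

lemma lt_retTime_of_fst_le {α β p₁ : ℝ} (hα : 0 < α) (hαβ : α < β) (hp₁ : 0 < p₁) (hp₁' : p₁ < 1)
    {p : ℝ × ℝ} (hp : p ∈ Δ0) {n : ℕ}
    (hle : ∀ k, 1 ≤ k → k ≤ n → ((skewLSV α β p₁)^[k] p).1 ≤ 1 / 2) : n < retTime α β p₁ p := by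
  obtain ⟨h1, h2⟩ := Nat.sInf_mem (exists_return hα hαβ hp₁ hp₁' hp :
    {n : ℕ | 1 ≤ n ∧ (skewLSV α β p₁)^[n] p ∈ Δ0}.Nonempty)
  by_contra! hn
  have h3 := hle _ h1 hn
  have h4 := h2.1.1
  linarith

/-- The number of times the parameter `α` is selected during the first `n` steps. -/
def alphaCount (p₁ : ℝ) (n : ℕ) (ω : ℝ) : ℝ :=
  ∑ k ∈ Finset.range n, if (phiMap p₁)^[k] ω < p₁ then 1 else 0

lemma alphaCount_succ (p₁ : ℝ) (n : ℕ) (ω : ℝ) :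
    alphaCount p₁ (n + 1) ω = alphaCount p₁ n ω + if (phiMap p₁)^[n] ω < p₁ then 1 else 0 :=
  Finset.sum_range_succ _ _

lemma alphaCount_mono (p₁ ω : ℝ) {m n : ℕ} (hmn : m ≤ n) :
    alphaCount p₁ m ω ≤ alphaCount p₁ n ω :=
  Finset.sum_le_sum_of_subset_of_nonneg (Finset.range_subset_range.2 hmn)
    fun i _ _ => by split_ifs <;> norm_num

lemma alphaCount_one_le (p₁ ω : ℝ) : alphaCount p₁ 1 ω ≤ 1 := by
  simp only [alphaCount, Finset.sum_range_one]
  split_ifs <;> norm_num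

lemma alphaCount_nonneg (p₁ : ℝ) (n : ℕ) (ω : ℝ) : 0 ≤ alphaCount p₁ n ω :=
  Finset.sum_nonneg fun i _ => by split_ifs <;> norm_num

lemma alphaCount_le (p₁ : ℝ) (n : ℕ) (ω : ℝ) : alphaCount p₁ n ω ≤ n := by
  have : alphaCount p₁ n ω ≤ ∑ _k ∈ Finset.range n, (1 : ℝ) :=
    Finset.sum_le_sum fun i _ => by split_ifs <;> norm_num
  simpa using this

lemma potential_of_lt_retTime {α β p₁ : ℝ} (hα : 0 < α) (hα1 : α ≤ 1) (hαβ : α < β) (hp₁ : 0 < p₁)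
    (hp₁' : p₁ < 1) {p : ℝ × ℝ} (hp : p ∈ Δ0) {n : ℕ} (hn : 1 ≤ n) (hR : n < retTime α β p₁ p) :
    α * 2 ^ α * (alphaCount p₁ n p.2 - 1) ≤ potential α (2 * p.1 - 1) := by
  have hmem := skewLSV_iterate_mem hα hαβ hp₁ hp₁' hp
  have hC : 0 < α * 2 ^ α := by positivity
  suffices H : ∀ k, 1 ≤ k → k ≤ n → potential α ((skewLSV α β p₁)^[k] p).1 +
      α * 2 ^ α * (alphaCount p₁ k p.2 - 1) ≤ potential α (2 * p.1 - 1) by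
    have h1 := H n hn le_rfl
    have h2 := potential_nonneg (c := α) (hmem n).1.1 (hmem n).1.2
    linarith
  intro k hk
  induction k, hk using Nat.le_induction with
  | base =>
    intro _
    rw [skewLSV_iterate_one_fst hp]
    nlinarith [alphaCount_one_le p₁ p.2]
  | succ k hk ih =>
    intro hkn
    have h1 := ih (by omega)
    have h2 := fst_le_of_lt_retTime hα hαβ hp₁ hp₁' hp hk (by omega)
    rw [skewLSV_iterate_succ_fst, alphaCount_succ]
    by_cases hω : (phiMap p₁)^[k] p.2 < p₁
    · have h3 := potential_lsv_le hα hα1 (hmem k).1.1 h2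
      rw [if_pos hω, alphaOf, if_pos hω]
      linarith
    · have h3 := potential_anti hα (hmem k).1.1 (le_lsv (a := β) (hmem k).1.1 h2)
      rw [if_neg hω, alphaOf, if_neg hω]
      linarith

/-- Points of `Δ₀` returning late, along a noise with many `α`-steps, are close to `1/2`. -/
lemma fst_le_of_lt_retTime_of_count {α β p₁ : ℝ} (hα : 0 < α) (hα1 : α ≤ 1) (hαβ : α < β)
    (hp₁ : 0 < p₁) (hp₁' : p₁ < 1) {D : ℝ} (hD : 0 < D) (hD' : D < α * 2 ^ α * p₁) :
    ∃ ε, 0 < ε ∧ ε ≤ 1 ∧ ∀ᶠ n : ℕ in atTop, ∀ p ∈ Δ0, n < retTime α β p₁ p →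
      (p₁ - ε) * n ≤ alphaCount p₁ n p.2 → 2 * p.1 - 1 ≤ (D * n) ^ (-(1 / α)) := by
  have hC : 0 < α * 2 ^ α := by positivity
  set C := α * 2 ^ α with hCdef
  obtain ⟨ε, hε, hεC⟩ : ∃ ε, 0 < ε ∧ 2 * (C * ε) = (C * p₁ - D) :=
    ⟨(C * p₁ - D) / (2 * C), by have := sub_pos.2 hD'; positivity, by field_simp⟩
  have hε1 : ε ≤ 1 := by nlinarith
  have hlog : ∀ᶠ n : ℕ in atTop, 8 / α * Real.log (D * n) + C < C * ε * n := by
    have ht : Tendsto (fun n : ℕ => D * (n : ℝ)) atTop atTop :=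
      tendsto_natCast_atTop_atTop.const_mul_atTop hD
    have h1 := (Real.isLittleO_log_id_atTop.comp_tendsto ht).bound
      (show 0 < α * (C * ε) / (16 * D) by positivity)
    filter_upwards [h1, tendsto_natCast_atTop_atTop.eventually_gt_atTop (2 / ε)] with n h1 h2
    have hn : (0 : ℝ) < n := lt_trans (by positivity) h2
    simp only [Function.comp, id, Real.norm_eq_abs] at h1
    rw [abs_of_pos (by positivity : 0 < D * (n : ℝ))] at h1
    have h3 := (le_abs_self _).trans h1
    have h4 : 8 / α * Real.log (D * n) ≤ 8 / α * (α * (C * ε) / (16 * D) * (D * n)) := by gcongr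
    have h5 : 8 / α * (α * (C * ε) / (16 * D) * (D * n)) = C * ε * n / 2 := by field_simp; norm_num
    rw [div_lt_iff₀ hε] at h2
    nlinarith
  refine ⟨ε, hε, hε1, ?_⟩
  filter_upwards [hlog, eventually_ge_atTop 1] with n hlog hn p hp hR hcount
  have hn' : (0 : ℝ) < n := by exact_mod_cast hn
  by_contra! hlt
  have hpot := potential_of_lt_retTime hα hα1 hαβ hp₁ hp₁' hp hn hR
  have hDn : 0 < D * n := by positivity
  have hbase : 0 < (D * n) ^ (-(1 / α)) := by positivity
  have h1 := potential_anti hα hbase hlt.le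
  have h2 : potential α ((D * n) ^ (-(1 / α))) = D * n + 8 / α * Real.log (D * n) := by
    unfold potential
    rw [← Real.rpow_mul hDn.le, Real.log_rpow hDn]
    have : -(1 / α) * -α = 1 := by field_simp
    rw [this, Real.rpow_one]
    ring
  rw [h2] at h1
  have h3 : C * ((p₁ - ε) * n) ≤ C * alphaCount p₁ n p.2 := by gcongr
  nlinarith

/-- Points of `Δ₀` close to `1/2`, along a noise with few `α`-steps, return late. -/
lemma lt_retTime_of_count {α β p₁ : ℝ} (hα : 0 < α) (hα1 : α ≤ 1) (hαβ : α < β)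
    (hp₁ : 0 < p₁) (hp₁' : p₁ < 1) {D : ℝ} (hD' : α * 2 ^ α * p₁ < D) :
    ∃ ε, 0 < ε ∧ ε ≤ 1 ∧ ∀ᶠ n : ℕ in atTop, ∀ p ∈ Δ0,
      alphaCount p₁ n p.2 ≤ (p₁ + ε) * n → 2 * p.1 - 1 ≤ (D * n) ^ (-(1 / α)) →
      n < retTime α β p₁ p := by
  have hC : 0 < α * 2 ^ α := by positivity
  set C := α * 2 ^ α with hCdef
  obtain ⟨ε, hε, hε1, hεC⟩ : ∃ ε, 0 < ε ∧ ε ≤ 1 ∧ C * ε ≤ (D - C * p₁) / 3 :=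
    ⟨min 1 ((D - C * p₁) / (3 * C)), by have := sub_pos.2 hD'; positivity, min_le_left _ _, by
      calc C * min 1 ((D - C * p₁) / (3 * C)) ≤ C * ((D - C * p₁) / (3 * C)) := by
            gcongr; exact min_le_right _ _
        _ = _ := by field_simp⟩
  set η := (D - C * p₁) / 3 with hηdef
  have hη : 0 < η := by have := sub_pos.2 hD'; positivity
  have hD : 0 < D := lt_trans (by positivity) hD'
  obtain ⟨r, hr, hr2, hrη⟩ : ∃ r, 0 < r ∧ r ≤ 1 / 2 ∧
      ∀ x, 0 < x → x ≤ r → α * 2 ^ β * x ^ (β - α) ≤ η := by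
    have hba : 0 < β - α := sub_pos.2 hαβ
    have hb : 0 < α * 2 ^ β := by positivity
    refine ⟨min (1 / 2) ((η / (α * 2 ^ β)) ^ (1 / (β - α))), by positivity, min_le_left _ _, ?_⟩
    intro x hx hxr
    have h1 : x ^ (β - α) ≤ ((η / (α * 2 ^ β)) ^ (1 / (β - α))) ^ (β - α) :=
      Real.rpow_le_rpow hx.le (hxr.trans (min_le_right _ _)) hba.le
    rw [← Real.rpow_mul (by positivity), one_div_mul_cancel hba.ne', Real.rpow_one] at h1
    calc α * 2 ^ β * x ^ (β - α) ≤ α * 2 ^ β * (η / (α * 2 ^ β)) := by gcongr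
      _ = η := by field_simp
  refine ⟨ε, hε, hε1, ?_⟩
  filter_upwards [tendsto_natCast_atTop_atTop.eventually_ge_atTop (r ^ (-α) / η),
    eventually_ge_atTop 1] with n hn hn1 p hp hcount hx
  have hn' : (0 : ℝ) < n := by exact_mod_cast hn1
  have hmem := skewLSV_iterate_mem hα hαβ hp₁ hp₁' hp
  rw [div_le_iff₀ hη] at hn
  have hx0 : 0 < 2 * p.1 - 1 := by linarith [hp.1.1]
  have hz : D * n ≤ (2 * p.1 - 1) ^ (-α) := by
    have h1 := Real.rpow_le_rpow_of_nonpos hx0 hx (by linarith : -α ≤ 0)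
    rw [← Real.rpow_mul (by positivity)] at h1
    have : -(1 / α) * -α = 1 := by field_simp
    rwa [this, Real.rpow_one] at h1
  have hsmall : ∀ k, k ≤ n → (2 * p.1 - 1) ^ (-α) - C * alphaCount p₁ k p.2 - η * k ≤
      ((skewLSV α β p₁)^[k] p).1 ^ (-α) → ((skewLSV α β p₁)^[k] p).1 ≤ r := by
    intro k hk h
    have h1 : C * alphaCount p₁ k p.2 ≤ C * ((p₁ + ε) * n) := by
      gcongr
      exact (alphaCount_mono p₁ p.2 hk).trans hcount
    have h2 : η * k ≤ η * n := by gcongr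
    have h3 : r ^ (-α) ≤ ((skewLSV α β p₁)^[k] p).1 ^ (-α) := by
      have h4 : C * ε * n ≤ η * n := by gcongr
      have h5 : D * n = C * p₁ * n + 3 * η * n := by rw [hηdef]; ring
      nlinarith
    exact (Real.rpow_le_rpow_iff_of_neg hr (hmem k).1.1 (by linarith : -α < 0)).1 h3
  have H : ∀ k, 1 ≤ k → k ≤ n → (2 * p.1 - 1) ^ (-α) - C * alphaCount p₁ k p.2 - η * k ≤
      ((skewLSV α β p₁)^[k] p).1 ^ (-α) := by
    intro k hk
    induction k, hk using Nat.le_induction with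
    | base =>
      intro _
      rw [skewLSV_iterate_one_fst hp]
      have := mul_nonneg hC.le (alphaCount_nonneg p₁ 1 p.2)
      push_cast
      linarith
    | succ k hk ih =>
      intro hkn
      have h1 := ih (by omega)
      have h2 := hsmall k (by omega) h1
      have h0 := (hmem k).1.1
      rw [skewLSV_iterate_succ_fst, alphaCount_succ]
      push_cast
      by_cases hω : (phiMap p₁)^[k] p.2 < p₁
      · have h3 := rpow_neg_sub_le_lsv (a := α) hα hα1 h0 (h2.trans hr2)
        rw [sub_self, Real.rpow_zero] at h3
        rw [if_pos hω, alphaOf, if_pos hω]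
        linarith
      · have h3 := rpow_neg_sub_le_lsv (a := β) hα hα1 h0 (h2.trans hr2)
        have h4 := hrη _ h0 h2
        rw [if_neg hω, alphaOf, if_neg hω]
        linarith
  exact lt_retTime_of_fst_le hα hαβ hp₁ hp₁' hp fun k hk hkn =>
    (hsmall k hkn (H k hk hkn)).trans hr2

/-! ### Large deviations of the number of `α`-steps -/

lemma measurable_phiMap (p₁ : ℝ) : Measurable (phiMap p₁) :=
  Measurable.ite measurableSet_Iio (by fun_prop) (by fun_prop)

lemma measurable_alphaCount (p₁ : ℝ) (n : ℕ) : Measurable (alphaCount p₁ n) := by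
  unfold alphaCount
  refine Finset.measurable_sum _ fun k _ => ?_
  exact Measurable.ite (((measurable_phiMap p₁).iterate k) measurableSet_Iio) measurable_const
    measurable_const

lemma alphaCount_succ' (p₁ : ℝ) (n : ℕ) (ω : ℝ) :
    alphaCount p₁ (n + 1) ω = alphaCount p₁ n (phiMap p₁ ω) + if ω < p₁ then 1 else 0 :=
  Finset.sum_range_succ' _ _

lemma integrable_exp_alphaCount (p₁ t : ℝ) (n : ℕ) {s : Set ℝ} (hs : volume s ≠ ⊤) :
    IntegrableOn (fun ω => Real.exp (t * alphaCount p₁ n ω)) s := by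
  refine Measure.integrableOn_of_bounded (M := Real.exp (|t| * n)) hs
    ((measurable_alphaCount p₁ n).const_mul t).exp.aestronglyMeasurable
    (Eventually.of_forall fun ω => ?_)
  rw [Real.norm_eq_abs, Real.abs_exp]
  refine Real.exp_le_exp.2 ((le_abs_self _).trans ?_)
  rw [abs_mul, abs_of_nonneg (alphaCount_nonneg p₁ n ω)]
  gcongr
  exact alphaCount_le p₁ n ω

lemma integral_exp_alphaCount {p₁ : ℝ} (hp₁ : 0 < p₁) (hp₁' : p₁ < 1) (t : ℝ) (n : ℕ) :
    ∫ ω in (0 : ℝ)..1, Real.exp (t * alphaCount p₁ n ω) = (p₁ * Real.exp t + (1 - p₁)) ^ n := by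
  have hq : 1 - p₁ ≠ 0 := by linarith
  induction n with
  | zero => simp [alphaCount]
  | succ n ih =>
    have hInt : ∀ a b : ℝ, IntervalIntegrable
        (fun ω => Real.exp (t * alphaCount p₁ (n + 1) ω)) volume a b := fun a b =>
      ⟨integrable_exp_alphaCount p₁ t _ (by simp), integrable_exp_alphaCount p₁ t _ (by simp)⟩
    rw [← intervalIntegral.integral_add_adjacent_intervals (hInt 0 p₁) (hInt p₁ 1)]
    let F : ℝ → ℝ := fun y => Real.exp (t * alphaCount p₁ n y)
    have h1 : ∫ ω in (0 : ℝ)..p₁, Real.exp (t * alphaCount p₁ (n + 1) ω) =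
        ∫ ω in (0 : ℝ)..p₁, Real.exp t * F (ω / p₁) := by
      refine intervalIntegral.integral_congr_ae ?_
      filter_upwards [Measure.ae_ne volume p₁] with ω hne hω
      rw [uIoc_of_le hp₁.le] at hω
      have hlt : ω < p₁ := lt_of_le_of_ne hω.2 hne
      rw [alphaCount_succ', if_pos hlt, phiMap, if_pos hlt, ← Real.exp_add]
      congr 1; ring
    have h2 : ∫ ω in p₁..1, Real.exp (t * alphaCount p₁ (n + 1) ω) =
        ∫ ω in p₁..1, F (ω / (1 - p₁) - p₁ / (1 - p₁)) := by
      refine intervalIntegral.integral_congr fun ω hω => ?_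
      rw [uIcc_of_le hp₁'.le] at hω
      simp only [F]
      rw [alphaCount_succ', if_neg hω.1.not_gt, phiMap, if_neg hω.1.not_gt, add_zero, sub_div]
    rw [h1, h2, intervalIntegral.integral_const_mul, intervalIntegral.integral_comp_div F hp₁.ne',
      intervalIntegral.integral_comp_div_sub F hq, zero_div, div_self hp₁.ne', sub_self,
      ← sub_div, div_self hq, show ∫ ω in (0 : ℝ)..1, F ω = _ from ih]
    simp only [smul_eq_mul]
    ring

lemma mgf_bound {p t : ℝ} (hp : 0 ≤ p) (hp1 : p ≤ 1) (ht : |t| ≤ 1) :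
    p * Real.exp t + (1 - p) ≤ Real.exp (p * t + t ^ 2) := by
  have h1 := (abs_le.1 (Real.abs_exp_sub_one_sub_id_le ht)).2
  have h2 := Real.add_one_le_exp (p * t + t ^ 2)
  nlinarith [mul_le_mul_of_nonneg_left h1 hp, sq_nonneg t]

lemma volume_exp_alphaCount_le {p₁ : ℝ} (hp₁ : 0 < p₁) (hp₁' : p₁ < 1) {t : ℝ} (ht : |t| ≤ 1)
    (n : ℕ) (a : ℝ) :
    volume {ω ∈ Icc (0 : ℝ) 1 | a ≤ t * alphaCount p₁ n ω} ≤
      ENNReal.ofReal (Real.exp ((p₁ * t + t ^ 2) * n - a)) := by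
  have hmeas : MeasurableSet {ω : ℝ | a ≤ t * alphaCount p₁ n ω} :=
    measurableSet_le measurable_const ((measurable_alphaCount p₁ n).const_mul t)
  have hmarkov := mul_meas_ge_le_integral_of_nonneg
    (μ := volume.restrict (Icc (0 : ℝ) 1)) (f := fun ω => Real.exp (t * alphaCount p₁ n ω))
    (Eventually.of_forall fun ω => (Real.exp_pos _).le)
    (integrable_exp_alphaCount p₁ t n (by simp)) (Real.exp a)
  rw [integral_Icc_eq_integral_Ioc, ← intervalIntegral.integral_of_le zero_le_one,
    integral_exp_alphaCount hp₁ hp₁'] at hmarkov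
  simp only [Real.exp_le_exp] at hmarkov
  have heq : (volume.restrict (Icc (0 : ℝ) 1)).real {ω : ℝ | a ≤ t * alphaCount p₁ n ω} =
      volume.real {ω ∈ Icc (0 : ℝ) 1 | a ≤ t * alphaCount p₁ n ω} := by
    rw [measureReal_restrict_apply hmeas, inter_comm]; rfl
  rw [heq] at hmarkov
  have hfin : volume {ω ∈ Icc (0 : ℝ) 1 | a ≤ t * alphaCount p₁ n ω} ≠ ⊤ :=
    measure_ne_top_of_subset (sep_subset _ _) (by simp)
  rw [← ENNReal.ofReal_toReal hfin]
  refine ENNReal.ofReal_le_ofReal ?_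
  have h1 : (p₁ * Real.exp t + (1 - p₁)) ^ n ≤ Real.exp ((p₁ * t + t ^ 2) * n) := by
    rw [mul_comm _ (n : ℝ), Real.exp_nat_mul]
    have : 0 ≤ p₁ * Real.exp t + (1 - p₁) := by
      have := Real.exp_pos t
      have : 0 < p₁ * Real.exp t := by positivity
      linarith
    gcongr
    exact mgf_bound hp₁.le hp₁'.le ht
  rw [Real.exp_sub, le_div_iff₀ (Real.exp_pos a), mul_comm]
  exact hmarkov.trans h1

lemma volume_alphaCount_gt_le {p₁ ε : ℝ} (hp₁ : 0 < p₁) (hp₁' : p₁ < 1) (hε : 0 < ε)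
    (hε1 : ε ≤ 1) (n : ℕ) :
    volume {ω ∈ Icc (0 : ℝ) 1 | (p₁ + ε) * n < alphaCount p₁ n ω} ≤
      ENNReal.ofReal (Real.exp (-(ε ^ 2 / 4) * n)) := by
  have h := volume_exp_alphaCount_le hp₁ hp₁' (t := ε / 2)
    (by rw [abs_of_pos (by positivity)]; linarith) n (ε / 2 * ((p₁ + ε) * n))
  have he : (p₁ * (ε / 2) + (ε / 2) ^ 2) * n - ε / 2 * ((p₁ + ε) * n) = -(ε ^ 2 / 4) * n := by ring
  rw [he] at h
  refine (measure_mono ?_).trans h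
  rintro ω ⟨h1, h2⟩
  exact ⟨h1, by gcongr⟩

lemma volume_alphaCount_lt_le {p₁ ε : ℝ} (hp₁ : 0 < p₁) (hp₁' : p₁ < 1) (hε : 0 < ε)
    (hε1 : ε ≤ 1) (n : ℕ) :
    volume {ω ∈ Icc (0 : ℝ) 1 | alphaCount p₁ n ω < (p₁ - ε) * n} ≤
      ENNReal.ofReal (Real.exp (-(ε ^ 2 / 4) * n)) := by
  have h := volume_exp_alphaCount_le hp₁ hp₁' (t := -(ε / 2))
    (by rw [abs_neg, abs_of_pos (by positivity)]; linarith) n (-(ε / 2) * ((p₁ - ε) * n))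
  have he : (p₁ * -(ε / 2) + (-(ε / 2)) ^ 2) * n - -(ε / 2) * ((p₁ - ε) * n) =
      -(ε ^ 2 / 4) * n := by ring
  rw [he] at h
  refine (measure_mono ?_).trans h
  rintro ω ⟨h1, h2⟩
  refine ⟨h1, ?_⟩
  have := mul_le_mul_of_nonneg_left h2.le (by positivity : 0 ≤ ε / 2)
  linarith

/-! ### Positivity of the density on the line `x = 1/2` -/

/-- On `V`, the measure `ν` dominates a positive multiple of Lebesgue measure. -/
def Minorized (ν : Measure (ℝ × ℝ)) (V : Set (ℝ × ℝ)) : Prop :=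
  ∃ ε : ENNReal, ε ≠ 0 ∧ ∀ E ⊆ V, MeasurableSet E → ε * volume E ≤ ν E

lemma Minorized.mono {ν : Measure (ℝ × ℝ)} {V W : Set (ℝ × ℝ)} (hV : Minorized ν V)
    (hWV : W ⊆ V) : Minorized ν W := by
  obtain ⟨ε, hε, h⟩ := hV
  exact ⟨ε, hε, fun E hE => h E (hE.trans hWV)⟩

lemma volume_image_le {f : ℝ × ℝ → ℝ × ℝ} {K : NNReal} {s : Set (ℝ × ℝ)}
    (hf : LipschitzOnWith K f s) : volume (f '' s) ≤ (K : ENNReal) ^ (2 : ℝ) * volume s := by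
  rw [← hausdorffMeasure_prod_real]
  exact hf.hausdorffMeasure_image_le zero_le_two

lemma Minorized.image {ν : Measure (ℝ × ℝ)} {S : ℝ × ℝ → ℝ × ℝ} (hS : Measurable S)
    (hinv : ∀ A : Set (ℝ × ℝ), MeasurableSet A → ν (S ⁻¹' A) = ν A) {V W : Set (ℝ × ℝ)}
    (hV : Minorized ν V) (hVm : MeasurableSet V) {K : NNReal} (hK : LipschitzOnWith K S V)
    (hW : W ⊆ S '' V) : Minorized ν W := by
  obtain ⟨ε, hε, h⟩ := hV
  have hK1 : LipschitzOnWith (K + 1) S V := hK.weaken (by simp)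
  set c : ENNReal := ((K + 1 : NNReal) : ENNReal) ^ (2 : ℝ) with hc
  have hc0 : c ≠ 0 := by rw [hc]; simp
  have hct : c ≠ ⊤ := ENNReal.rpow_ne_top_of_nonneg zero_le_two ENNReal.coe_ne_top
  refine ⟨ε / c, (ENNReal.div_pos hε hct).ne', fun E hE hEm => ?_⟩
  have hF : V ∩ S ⁻¹' E ⊆ V := inter_subset_left
  have h1 : volume E ≤ c * volume (V ∩ S ⁻¹' E) := by
    refine (measure_mono ?_).trans (volume_image_le (hK1.mono hF))
    intro y hy
    obtain ⟨x, hx, rfl⟩ := hW (hE hy)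
    exact ⟨x, ⟨hx, hy⟩, rfl⟩
  calc ε / c * volume E ≤ ε / c * (c * volume (V ∩ S ⁻¹' E)) := by gcongr
    _ = ε * volume (V ∩ S ⁻¹' E) := by rw [← mul_assoc, ENNReal.div_mul_cancel hc0 hct]
    _ ≤ ν (V ∩ S ⁻¹' E) := h _ hF (hVm.inter (hS hEm))
    _ ≤ ν (S ⁻¹' E) := measure_mono inter_subset_right
    _ = ν E := hinv E hEm

lemma measurable_skewLSV (α β p₁ : ℝ) : Measurable (skewLSV α β p₁) := by
  have h1 : Measurable fun p : ℝ × ℝ => alphaOf α β p₁ p.2 :=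
    Measurable.ite (measurable_snd measurableSet_Iio) measurable_const measurable_const
  have h2 : Measurable fun p : ℝ × ℝ => lsv (alphaOf α β p₁ p.2) p.1 :=
    Measurable.ite (measurable_fst measurableSet_Iic)
      (measurable_fst.mul (measurable_const.add
        ((measurable_const.pow h1).mul (measurable_fst.pow h1)))) (by fun_prop)
  exact h2.prodMk ((measurable_phiMap p₁).comp measurable_snd)

lemma Minorized.image_rect {ν : Measure (ℝ × ℝ)} {α β p₁ : ℝ}
    (hinv : ∀ A : Set (ℝ × ℝ), MeasurableSet A → ν (skewLSV α β p₁ ⁻¹' A) = ν A)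
    {a b c d : ℝ} (hab : a ≤ b) (hcd : c ≤ d) {f g : ℝ → ℝ} {Kf Kg : NNReal}
    (hf : LipschitzOnWith Kf f (Icc a b)) (hg : LipschitzOnWith Kg g (Icc c d))
    (hS : ∀ p ∈ Ioo a b ×ˢ Ioo c d, skewLSV α β p₁ p = (f p.1, g p.2))
    (hV : Minorized ν (Ioo a b ×ˢ Ioo c d)) :
    Minorized ν (Ioo (f a) (f b) ×ˢ Ioo (g c) (g d)) := by
  have hlip : LipschitzOnWith (max Kf Kg) (skewLSV α β p₁) (Ioo a b ×ˢ Ioo c d) := by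
    have h1 : LipschitzOnWith (max Kf Kg) (fun p : ℝ × ℝ => (f p.1, g p.2))
        (Ioo a b ×ˢ Ioo c d) := by
      have h2 : LipschitzOnWith (Kf * 1) (f ∘ Prod.fst) (Ioo a b ×ˢ Ioo c d) :=
        hf.comp LipschitzWith.prod_fst.lipschitzOnWith fun p hp => Ioo_subset_Icc_self hp.1
      have h3 : LipschitzOnWith (Kg * 1) (g ∘ Prod.snd) (Ioo a b ×ˢ Ioo c d) :=
        hg.comp LipschitzWith.prod_snd.lipschitzOnWith fun p hp => Ioo_subset_Icc_self hp.2
      simpa using h2.prodMk h3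
    intro x hx y hy
    rw [hS x hx, hS y hy]
    exact h1 hx hy
  refine hV.image (measurable_skewLSV α β p₁) hinv (measurableSet_Ioo.prod measurableSet_Ioo)
    hlip ?_
  rintro ⟨u, v⟩ ⟨hu, hv⟩
  obtain ⟨x, hx, rfl⟩ := intermediate_value_Ioo hab hf.continuousOn hu
  obtain ⟨ω, hω, rfl⟩ := intermediate_value_Ioo hcd hg.continuousOn hv
  exact ⟨(x, ω), ⟨hx, hω⟩, hS _ ⟨hx, hω⟩⟩

lemma lipschitzOnWith_lsv_left {e : ℝ} (he : 0 < e) :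
    ∃ K, LipschitzOnWith K (fun x : ℝ => x * (1 + (2 : ℝ) ^ e * x ^ e)) (Icc 0 (1 / 2)) := by
  refine ⟨(1 + 2 ^ e * (1 + e)).toNNReal, ?_⟩
  have h1 : LipschitzOnWith (1 + 2 ^ e * (1 + e)).toNNReal
      (fun x : ℝ => x + (2 : ℝ) ^ e * x ^ (1 + e)) (Icc 0 (1 / 2)) := by
    refine (convex_Icc (0 : ℝ) (1 / 2)).lipschitzOnWith_of_nnnorm_hasDerivWithin_le
      (f' := fun x => 1 + 2 ^ e * ((1 + e) * x ^ (1 + e - 1))) (fun x _ => ?_) fun x hx => ?_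
    · exact ((hasDerivAt_id x).add ((Real.hasDerivAt_rpow_const
        (Or.inr (by linarith))).const_mul _)).hasDerivWithinAt
    · have h0 : 0 ≤ x ^ (1 + e - 1) := Real.rpow_nonneg hx.1 _
      have h1 : x ^ (1 + e - 1) ≤ 1 :=
        Real.rpow_le_one hx.1 (by linarith [hx.2]) (by linarith)
      rw [← NNReal.coe_le_coe, coe_nnnorm, Real.norm_of_nonneg (by positivity),
        Real.coe_toNNReal _ (by positivity)]
      gcongr
      nlinarith
  intro x hx y hy
  have h2 : ∀ z ∈ Icc (0 : ℝ) (1 / 2), z * (1 + (2 : ℝ) ^ e * z ^ e) = z + 2 ^ e * z ^ (1 + e) := by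
    intro z hz
    rw [Real.rpow_add' hz.1 (by linarith), Real.rpow_one]
    ring
  simp only [h2 x hx, h2 y hy]
  exact h1 hx hy

lemma mul_sub_le_lsv_sub {e a b : ℝ} (he : 0 < e) (ha : 0 ≤ a) (hab : a < b) :
    (b - a) * (1 + (2 * (b - a)) ^ e) ≤
      b * (1 + (2 : ℝ) ^ e * b ^ e) - a * (1 + (2 : ℝ) ^ e * a ^ e) := by
  rw [← Real.mul_rpow zero_le_two ha, ← Real.mul_rpow zero_le_two (ha.trans hab.le)]
  have h1 : (2 * a) ^ e ≤ (2 * b) ^ e := Real.rpow_le_rpow (by linarith) (by linarith) he.le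
  have h2 : (2 * (b - a)) ^ e ≤ (2 * b) ^ e := Real.rpow_le_rpow (by linarith) (by linarith) he.le
  have h3 : 0 < b - a := by linarith
  nlinarith

/-- Pushing forward a minorized rectangle that lies on one side of the line `x = 1/2`. -/
lemma Minorized.step {ν : Measure (ℝ × ℝ)} {α β p₁ : ℝ}
    (hinv : ∀ A : Set (ℝ × ℝ), MeasurableSet A → ν (skewLSV α β p₁ ⁻¹' A) = ν A)
    {e : ℝ} (he : 0 < e) {a b c d : ℝ} (ha : 0 ≤ a) (hab : a < b) (hb : b ≤ 1)
    (hside : b ≤ 1 / 2 ∨ 1 / 2 ≤ a) (hcd : c ≤ d) {g : ℝ → ℝ} {Kg : NNReal}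
    (hg : LipschitzOnWith Kg g (Icc c d))
    (hbranch : ∀ ω ∈ Ioo c d, alphaOf α β p₁ ω = e ∧ phiMap p₁ ω = g ω)
    (hV : Minorized ν (Ioo a b ×ˢ Ioo c d)) :
    ∃ a' b', 0 ≤ a' ∧ b' ≤ 1 ∧ (b - a) * min 2 (1 + (2 * (b - a)) ^ e) ≤ b' - a' ∧
      Minorized ν (Ioo a' b' ×ˢ Ioo (g c) (g d)) := by
  have hba : 0 < b - a := by linarith
  rcases hside with hside | hside
  · obtain ⟨K, hK⟩ := lipschitzOnWith_lsv_left he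
    refine ⟨_, _, ?_, ?_, ?_, hV.image_rect hinv hab.le hcd
      (hK.mono (Icc_subset_Icc ha hside)) hg fun p hp => ?_⟩
    · positivity
    · have h1 := lsv_mem_Ioc he (x := b) ⟨by linarith, hb⟩
      rw [lsv_of_le hside] at h1
      exact h1.2
    · refine le_trans ?_ (mul_sub_le_lsv_sub he ha hab)
      gcongr
      exact min_le_right _ _
    · obtain ⟨h1, h2⟩ := hbranch p.2 hp.2
      rw [skewLSV, h1, h2, lsv_of_le (hp.1.2.le.trans hside)]
  · have hlip : LipschitzWith 2 (fun x : ℝ => 2 * x - 1) := by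
      refine LipschitzWith.of_dist_le_mul fun x y => ?_
      rw [Real.dist_eq, Real.dist_eq, show 2 * x - 1 - (2 * y - 1) = 2 * (x - y) by ring, abs_mul]
      simp
    refine ⟨2 * a - 1, 2 * b - 1, by linarith, by linarith, ?_,
      hV.image_rect hinv hab.le hcd hlip.lipschitzOnWith hg fun p hp => ?_⟩
    · calc (b - a) * min 2 (1 + (2 * (b - a)) ^ e) ≤ (b - a) * 2 := by
            gcongr; exact min_le_left _ _
        _ = _ := by ring
    · obtain ⟨h1, h2⟩ := hbranch p.2 hp.2
      rw [skewLSV, h1, h2, lsv_of_lt (lt_of_le_of_lt hside hp.1.1)]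

lemma Minorized.exists_side {ν : Measure (ℝ × ℝ)} {a b : ℝ} {J : Set ℝ} (hab : a < b)
    (hV : Minorized ν (Ioo a b ×ˢ J)) :
    ∃ a' b', a ≤ a' ∧ a' < b' ∧ b' ≤ b ∧ (b' ≤ 1 / 2 ∨ 1 / 2 ≤ a') ∧
      Minorized ν (Ioo a' b' ×ˢ J) := by
  rcases le_or_gt (1 / 2) a with h | h
  · exact ⟨a, b, le_rfl, hab, le_rfl, Or.inr h, hV⟩
  · exact ⟨a, min b (1 / 2), le_rfl, lt_min hab h, min_le_left _ _, Or.inl (min_le_right _ _),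
      hV.mono (prod_mono (Ioo_subset_Ioo_right (min_le_left _ _)) Subset.rfl)⟩

/-- If a bounded quantity can be enlarged by a fixed factor until `Q` holds, then `Q` holds. -/
lemma of_forall_growth {P : ℝ → Prop} {Q : Prop} {l₀ κ : ℝ} (hl₀ : 0 < l₀) (hκ : 1 < κ)
    (h0 : P l₀) (hbdd : ∀ l, P l → l ≤ 1)
    (hstep : ∀ l, l₀ ≤ l → P l → Q ∨ ∃ l', κ * l ≤ l' ∧ P l') : Q := by
  by_contra hQ
  have H : ∀ n : ℕ, ∃ l, κ ^ n * l₀ ≤ l ∧ P l := by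
    intro n
    induction n with
    | zero => exact ⟨l₀, by simp, h0⟩
    | succ n ih =>
      obtain ⟨l, hl, hPl⟩ := ih
      have hl0 : l₀ ≤ l := le_trans (le_mul_of_one_le_left hl₀.le (one_le_pow₀ hκ.le)) hl
      rcases hstep l hl0 hPl with h | ⟨l', hl', hPl'⟩
      · exact absurd h hQ
      · refine ⟨l', le_trans ?_ hl', hPl'⟩
        rw [pow_succ', mul_assoc]
        gcongr
  obtain ⟨n, hn⟩ := pow_unbounded_of_one_lt (1 / l₀) hκ
  obtain ⟨l, hl, hPl⟩ := H n
  rw [div_lt_iff₀ hl₀] at hn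
  linarith [hbdd l hPl]

section Spreading

variable {ν : Measure (ℝ × ℝ)} {α β p₁ : ℝ}

lemma lipschitzOnWith_affine {q : ℝ} (hq : 0 < q) (s : ℝ) (J : Set ℝ) :
    ∃ K, LipschitzOnWith K (fun ω : ℝ => (ω - s) / q) J := by
  refine ⟨q⁻¹.toNNReal, LipschitzWith.lipschitzOnWith
    (LipschitzWith.of_dist_le_mul fun x y => ?_)⟩
  rw [Real.dist_eq, Real.dist_eq, ← sub_div, abs_div, abs_of_pos hq,
    show x - s - (y - s) = x - y by ring, Real.coe_toNNReal _ (by positivity), div_eq_inv_mul]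

lemma Minorized.step_left (hα : 0 < α) (hp₁ : 0 < p₁)
    (hinv : ∀ A : Set (ℝ × ℝ), MeasurableSet A → ν (skewLSV α β p₁ ⁻¹' A) = ν A)
    {a b c d : ℝ} (ha : 0 ≤ a) (hab : a < b) (hb : b ≤ 1)
    (hside : b ≤ 1 / 2 ∨ 1 / 2 ≤ a) (hcd : c ≤ d) (hd : d ≤ p₁)
    (hV : Minorized ν (Ioo a b ×ˢ Ioo c d)) :
    ∃ a' b', 0 ≤ a' ∧ b' ≤ 1 ∧ (b - a) * min 2 (1 + (2 * (b - a)) ^ α) ≤ b' - a' ∧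
      Minorized ν (Ioo a' b' ×ˢ Ioo (c / p₁) (d / p₁)) := by
  obtain ⟨K, hK⟩ := lipschitzOnWith_affine hp₁ 0 (Icc c d)
  have := hV.step hinv hα ha hab hb hside hcd hK fun ω hω => by
    have h : ω < p₁ := hω.2.trans_le hd
    rw [alphaOf, phiMap, if_pos h, if_pos h, sub_zero]
    exact ⟨rfl, rfl⟩
  simpa using this

lemma Minorized.step_right (hβ : 0 < β) (hp₁' : p₁ < 1)
    (hinv : ∀ A : Set (ℝ × ℝ), MeasurableSet A → ν (skewLSV α β p₁ ⁻¹' A) = ν A)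
    {a b c d : ℝ} (ha : 0 ≤ a) (hab : a < b) (hb : b ≤ 1)
    (hside : b ≤ 1 / 2 ∨ 1 / 2 ≤ a) (hcd : c ≤ d) (hc : p₁ ≤ c)
    (hV : Minorized ν (Ioo a b ×ˢ Ioo c d)) :
    ∃ a' b', 0 ≤ a' ∧ b' ≤ 1 ∧ (b - a) * min 2 (1 + (2 * (b - a)) ^ β) ≤ b' - a' ∧
      Minorized ν (Ioo a' b' ×ˢ Ioo ((c - p₁) / (1 - p₁)) ((d - p₁) / (1 - p₁))) := by
  obtain ⟨K, hK⟩ := lipschitzOnWith_affine (sub_pos.2 hp₁') p₁ (Icc c d)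
  exact hV.step hinv hβ ha hab hb hside hcd hK fun ω hω => by
    have h : ¬ ω < p₁ := (hc.trans hω.1.le).not_gt
    rw [alphaOf, phiMap, if_neg h, if_neg h]
    exact ⟨rfl, rfl⟩

lemma lt_of_growth {l l' e : ℝ} (hl : 0 < l) (h : l * min 2 (1 + (2 * l) ^ e) ≤ l') : 0 < l' := by
  have : 0 < min 2 (1 + (2 * l) ^ e) := lt_min two_pos (by positivity)
  exact lt_of_lt_of_le (by positivity) h

/-- A minorized rectangle gives one whose noise fibre starts at `0`. -/
lemma Minorized.exists_fibre_zero (hα : 0 < α) (hβ : 0 < β) (hp₁ : 0 < p₁) (hp₁' : p₁ < 1)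
    (hinv : ∀ A : Set (ℝ × ℝ), MeasurableSet A → ν (skewLSV α β p₁ ⁻¹' A) = ν A)
    {a b c d : ℝ} (ha : 0 ≤ a) (hab : a < b) (hb : b ≤ 1) (hc : 0 ≤ c) (hcd : c < d) (hd : d ≤ 1)
    (hV : Minorized ν (Ioo a b ×ˢ Ioo c d)) :
    ∃ a b d, 0 ≤ a ∧ a < b ∧ b ≤ 1 ∧ 0 < d ∧ d ≤ 1 ∧ Minorized ν (Ioo a b ×ˢ Ioo 0 d) := by
  have hq : 0 < 1 - p₁ := sub_pos.2 hp₁'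
  have hm : 0 < min p₁⁻¹ (1 - p₁)⁻¹ := lt_min (by positivity) (by positivity)
  refine of_forall_growth (P := fun l => ∃ a b c d, 0 ≤ a ∧ a < b ∧ b ≤ 1 ∧ 0 ≤ c ∧ c < d ∧ d ≤ 1 ∧
      l = d - c ∧ Minorized ν (Ioo a b ×ˢ Ioo c d)) (κ := min p₁⁻¹ (1 - p₁)⁻¹) (sub_pos.2 hcd)
    (lt_min ((one_lt_inv₀ hp₁).2 hp₁') ((one_lt_inv₀ hq).2 (by linarith)))
    ⟨a, b, c, d, ha, hab, hb, hc, hcd, hd, rfl, hV⟩ ?_ ?_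
  · rintro l ⟨a, b, c, d, -, -, -, hc, -, hd, rfl, -⟩
    linarith
  · rintro l - ⟨a, b, c, d, ha, hab, hb, hc, hcd, hd, rfl, hV⟩
    obtain ⟨a', b', haa, hab', hbb, hside, hV'⟩ := hV.exists_side hab
    rcases le_or_gt d p₁ with h | h
    · obtain ⟨a₁, b₁, h0, h1, hl, hV₁⟩ := hV'.step_left hα hp₁ hinv (ha.trans haa) hab'
        (hbb.trans hb) hside hcd.le h
      refine Or.inr ⟨d / p₁ - c / p₁, ?_, a₁, b₁, c / p₁, d / p₁, h0,
        sub_pos.1 (lt_of_growth (sub_pos.2 hab') hl), h1, by positivity, by gcongr,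
        (div_le_one hp₁).2 h, rfl, hV₁⟩
      rw [← sub_div, div_eq_inv_mul]
      have := sub_pos.2 hcd
      gcongr
      exact min_le_left _ _
    rcases le_or_gt p₁ c with h' | h'
    · obtain ⟨a₁, b₁, h0, h1, hl, hV₁⟩ := hV'.step_right hβ hp₁' hinv (ha.trans haa) hab'
        (hbb.trans hb) hside hcd.le h'
      refine Or.inr ⟨(d - p₁) / (1 - p₁) - (c - p₁) / (1 - p₁), ?_, a₁, b₁, _, _, h0,
        sub_pos.1 (lt_of_growth (sub_pos.2 hab') hl), h1, div_nonneg (sub_nonneg.2 h') hq.le,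
        by gcongr, (div_le_one hq).2 (by linarith), rfl, hV₁⟩
      rw [← sub_div, sub_sub_sub_cancel_right, div_eq_inv_mul]
      have := sub_pos.2 hcd
      gcongr
      exact min_le_right _ _
    · left
      obtain ⟨a₁, b₁, h0, h1, hl, hV₁⟩ := (hV'.mono (prod_mono Subset.rfl
          (Ioo_subset_Ioo_left h'.le))).step_right hβ hp₁' hinv (ha.trans haa) hab'
        (hbb.trans hb) hside h.le le_rfl
      rw [sub_self, zero_div] at hV₁
      exact ⟨a₁, b₁, _, h0, sub_pos.1 (lt_of_growth (sub_pos.2 hab') hl), h1,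
        div_pos (sub_pos.2 h) hq, (div_le_one hq).2 (by linarith), hV₁⟩

/-- A minorized rectangle gives one whose noise fibre is full. -/
lemma Minorized.exists_fibre_full (hα : 0 < α) (hp₁ : 0 < p₁) (hp₁' : p₁ < 1)
    (hinv : ∀ A : Set (ℝ × ℝ), MeasurableSet A → ν (skewLSV α β p₁ ⁻¹' A) = ν A)
    {a b d : ℝ} (ha : 0 ≤ a) (hab : a < b) (hb : b ≤ 1) (hd0 : 0 < d) (hd : d ≤ 1)
    (hV : Minorized ν (Ioo a b ×ˢ Ioo 0 d)) :
    ∃ a b, 0 ≤ a ∧ a < b ∧ b ≤ 1 ∧ Minorized ν (Ioo a b ×ˢ Ioo 0 1) := by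
  refine of_forall_growth (P := fun l => ∃ a b, 0 ≤ a ∧ a < b ∧ b ≤ 1 ∧ l ≤ 1 ∧
      Minorized ν (Ioo a b ×ˢ Ioo 0 l)) (κ := p₁⁻¹) hd0 ((one_lt_inv₀ hp₁).2 hp₁')
    ⟨a, b, ha, hab, hb, hd, hV⟩ ?_ ?_
  · rintro l ⟨a, b, -, -, -, hl, -⟩
    exact hl
  · rintro l hdl ⟨a, b, ha, hab, hb, hl1, hV⟩
    obtain ⟨a', b', haa, hab', hbb, hside, hV'⟩ := hV.exists_side hab
    rcases le_or_gt l p₁ with h | h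
    · obtain ⟨a₁, b₁, h0, h1, hl, hV₁⟩ := hV'.step_left hα hp₁ hinv (ha.trans haa) hab'
        (hbb.trans hb) hside (hd0.le.trans hdl) h
      rw [zero_div] at hV₁
      exact Or.inr ⟨l / p₁, (div_eq_inv_mul _ _).ge, a₁, b₁, h0,
        sub_pos.1 (lt_of_growth (sub_pos.2 hab') hl), h1, (div_le_one hp₁).2 h, hV₁⟩
    · obtain ⟨a₁, b₁, h0, h1, hl, hV₁⟩ := (hV'.mono (prod_mono Subset.rfl
          (Ioo_subset_Ioo_right h.le))).step_left hα hp₁ hinv (ha.trans haa) hab'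
        (hbb.trans hb) hside hp₁.le le_rfl
      rw [zero_div, div_self hp₁.ne'] at hV₁
      exact Or.inl ⟨a₁, b₁, h0, sub_pos.1 (lt_of_growth (sub_pos.2 hab') hl), h1, hV₁⟩

/-- A minorized rectangle gives one around the segment `{1/2} × (0,1)`. -/
lemma Minorized.exists_half (hα : 0 < α) (hp₁ : 0 < p₁) (hp₁' : p₁ < 1)
    (hinv : ∀ A : Set (ℝ × ℝ), MeasurableSet A → ν (skewLSV α β p₁ ⁻¹' A) = ν A)
    {a b : ℝ} (ha : 0 ≤ a) (hab : a < b) (hb : b ≤ 1)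
    (hV : Minorized ν (Ioo a b ×ˢ Ioo 0 1)) :
    ∃ a b, a < 1 / 2 ∧ 1 / 2 < b ∧ Minorized ν (Ioo a b ×ˢ Ioo 0 1) := by
  have hba := sub_pos.2 hab
  have hpow : 0 < (2 * (b - a)) ^ α := by positivity
  refine of_forall_growth (P := fun l => ∃ a b, 0 ≤ a ∧ a < b ∧ b ≤ 1 ∧ l = b - a ∧
      Minorized ν (Ioo a b ×ˢ Ioo 0 1)) (κ := min 2 (1 + (2 * (b - a)) ^ α)) hba
    (lt_min one_lt_two (by linarith)) ⟨a, b, ha, hab, hb, rfl, hV⟩ ?_ ?_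
  · rintro l ⟨a, b, ha, -, hb, rfl, -⟩
    linarith
  · rintro l hl ⟨a', b', ha', hab', hb', rfl, hV'⟩
    by_cases hside : b' ≤ 1 / 2 ∨ 1 / 2 ≤ a'
    · right
      obtain ⟨a₁, b₁, h0, h1, hl', hV₁⟩ := (hV'.mono (prod_mono Subset.rfl
          (Ioo_subset_Ioo_right hp₁'.le))).step_left hα hp₁ hinv ha' hab' hb' hside hp₁.le le_rfl
      rw [zero_div, div_self hp₁.ne'] at hV₁
      refine ⟨b₁ - a₁, le_trans ?_ hl', a₁, b₁, h0,
        sub_pos.1 (lt_of_growth (sub_pos.2 hab') hl'), h1, rfl, hV₁⟩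
      rw [mul_comm]
      have := sub_pos.2 hab'
      gcongr
    · push Not at hside
      exact Or.inl ⟨a', b', hside.2, hside.1, hV'⟩

end Spreading

/-! ### Consequences of the local Lipschitz property of the density -/

section Density

variable {ν : Measure (ℝ × ℝ)} {h : ℝ × ℝ → ℝ}

lemma le_withDensity_of_le {c : ℝ}
    (hden : ν = volume.withDensity (fun p => ENNReal.ofReal (h p))) {E : Set (ℝ × ℝ)}
    (hE : MeasurableSet E) (hc : ∀ p ∈ E, c ≤ h p) : ENNReal.ofReal c * volume E ≤ ν E := by
  rw [hden, withDensity_apply _ hE, ← setLIntegral_const]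
  exact setLIntegral_mono' hE fun p hp => ENNReal.ofReal_le_ofReal (hc p hp)

lemma withDensity_le_of_le {c : ℝ}
    (hden : ν = volume.withDensity (fun p => ENNReal.ofReal (h p))) {E : Set (ℝ × ℝ)}
    (hE : MeasurableSet E) (hc : ∀ p ∈ E, h p ≤ c) : ν E ≤ ENNReal.ofReal c * volume E := by
  rw [hden, withDensity_apply _ hE, ← setLIntegral_const]
  exact setLIntegral_mono' hE fun p hp => ENNReal.ofReal_le_ofReal (hc p hp)

lemma exists_density_pos [IsProbabilityMeasure ν] (hac : ν ≪ (volume : Measure (ℝ × ℝ)))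
    (hsupp : ν ((Icc (0 : ℝ) 1 ×ˢ Icc (0 : ℝ) 1)ᶜ) = 0)
    (hden : ν = volume.withDensity (fun p => ENNReal.ofReal (h p))) :
    ∃ p ∈ Ioo (0 : ℝ) 1 ×ˢ Ioo (0 : ℝ) 1, 0 < h p := by
  by_contra! hle
  have h1 : ν (Ioo (0 : ℝ) 1 ×ˢ Ioo (0 : ℝ) 1) = 0 := by
    have := withDensity_le_of_le hden (measurableSet_Ioo.prod measurableSet_Ioo) hle
    simpa using this
  have h2 : (Ioo (0 : ℝ) 1 ×ˢ Ioo (0 : ℝ) 1 : Set (ℝ × ℝ)) =ᵐ[ν]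
      (Icc (0 : ℝ) 1 ×ˢ Icc (0 : ℝ) 1 : Set (ℝ × ℝ)) :=
    hac.ae_eq (Measure.set_prod_ae_eq Ioo_ae_eq_Icc Ioo_ae_eq_Icc)
  rw [measure_congr h2] at h1
  have h3 := measure_union_le (μ := ν) (Icc (0 : ℝ) 1 ×ˢ Icc (0 : ℝ) 1)
    (Icc (0 : ℝ) 1 ×ˢ Icc (0 : ℝ) 1)ᶜ
  rw [union_compl_self, measure_univ, h1, hsupp] at h3
  simp at h3

lemma continuousAt_of_forall_compact
    (hLip : ∀ K : Set (ℝ × ℝ), K ⊆ Ioc (0 : ℝ) 1 ×ˢ Icc (0 : ℝ) 1 → IsCompact K →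
      ∃ L : NNReal, LipschitzOnWith L h K) {p : ℝ × ℝ}
    (hp : p ∈ Ioo (0 : ℝ) 1 ×ˢ Ioo (0 : ℝ) 1) : ContinuousAt h p := by
  have hp1 := hp.1.1
  obtain ⟨L, hL⟩ := hLip (Icc (p.1 / 2) 1 ×ˢ Icc 0 1)
    (prod_mono (fun x hx => ⟨lt_of_lt_of_le (by linarith) hx.1, hx.2⟩) Subset.rfl)
    (isCompact_Icc.prod isCompact_Icc)
  exact hL.continuousOn.continuousAt
    (prod_mem_nhds (Icc_mem_nhds (by linarith) hp.1.2) (Icc_mem_nhds hp.2.1 hp.2.2))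

lemma exists_minorized [IsProbabilityMeasure ν] (hac : ν ≪ (volume : Measure (ℝ × ℝ)))
    (hsupp : ν ((Icc (0 : ℝ) 1 ×ˢ Icc (0 : ℝ) 1)ᶜ) = 0)
    (hden : ν = volume.withDensity (fun p => ENNReal.ofReal (h p)))
    (hLip : ∀ K : Set (ℝ × ℝ), K ⊆ Ioc (0 : ℝ) 1 ×ˢ Icc (0 : ℝ) 1 → IsCompact K →
      ∃ L : NNReal, LipschitzOnWith L h K) :
    ∃ a b c d, 0 ≤ a ∧ a < b ∧ b ≤ 1 ∧ 0 ≤ c ∧ c < d ∧ d ≤ 1 ∧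
      Minorized ν (Ioo a b ×ˢ Ioo c d) := by
  obtain ⟨p, hp, hpos⟩ := exists_density_pos hac hsupp hden
  have h1 : ∀ᶠ q in 𝓝 p, h p / 2 < h q :=
    (continuousAt_of_forall_compact hLip hp).eventually_const_lt (half_lt_self hpos)
  have h2 : Ioo (0 : ℝ) 1 ×ˢ Ioo (0 : ℝ) 1 ∈ 𝓝 p := (isOpen_Ioo.prod isOpen_Ioo).mem_nhds hp
  obtain ⟨r, hr, hball⟩ := Metric.mem_nhds_iff.1 (inter_mem h1 h2)
  rw [← Prod.mk.eta (p := p), ← ball_prod_same, Real.ball_eq_Ioo, Real.ball_eq_Ioo] at hball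
  have hn1 : p.1 - r < p.1 + r := by linarith
  have hn2 : p.2 - r < p.2 + r := by linarith
  have h3 := (prod_subset_prod_iff.1 (hball.trans inter_subset_right)).resolve_right (by
    rintro (h | h)
    · exact (nonempty_Ioo.2 hn1).ne_empty h
    · exact (nonempty_Ioo.2 hn2).ne_empty h)
  rw [Ioo_subset_Ioo_iff hn1, Ioo_subset_Ioo_iff hn2] at h3
  refine ⟨_, _, _, _, h3.1.1, hn1, h3.1.2, h3.2.1, hn2, h3.2.2, ENNReal.ofReal (h p / 2),
    by simpa using hpos, fun E hE hEm => le_withDensity_of_le hden hEm fun q hq => ?_⟩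
  exact (hball (hE hq)).1.le

lemma exists_pos_le_density
    (hden : ν = volume.withDensity (fun p => ENNReal.ofReal (h p)))
    (hLip : ∀ K : Set (ℝ × ℝ), K ⊆ Ioc (0 : ℝ) 1 ×ˢ Icc (0 : ℝ) 1 → IsCompact K →
      ∃ L : NNReal, LipschitzOnWith L h K) {a b : ℝ} (ha : a < 1 / 2) (hb : 1 / 2 < b)
    (hV : Minorized ν (Ioo a b ×ˢ Ioo 0 1)) :
    ∃ ε, 0 < ε ∧ ∀ ω ∈ Ioo (0 : ℝ) 1, ε ≤ h (1 / 2, ω) := by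
  obtain ⟨ε, hε, hmin⟩ := hV
  have hε1 : min ε 1 ≠ ⊤ := ne_top_of_le_ne_top ENNReal.one_ne_top (min_le_right _ _)
  have hpos : 0 < (min ε 1).toReal := ENNReal.toReal_pos (lt_min hε.bot_lt one_pos).ne' hε1
  refine ⟨(min ε 1).toReal / 2, half_pos hpos, fun ω hω => ?_⟩
  by_contra! hlt
  have hp : ((1 / 2 : ℝ), ω) ∈ Ioo (0 : ℝ) 1 ×ˢ Ioo (0 : ℝ) 1 := ⟨by constructor <;> norm_num, hω⟩
  have h1 : ∀ᶠ q in 𝓝 ((1 / 2 : ℝ), ω), h q < (min ε 1).toReal / 2 :=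
    (continuousAt_of_forall_compact hLip hp).eventually_lt_const hlt
  have h2 : Ioo a b ×ˢ Ioo (0 : ℝ) 1 ∈ 𝓝 ((1 / 2 : ℝ), ω) :=
    (isOpen_Ioo.prod isOpen_Ioo).mem_nhds ⟨⟨ha, hb⟩, hω⟩
  obtain ⟨r, hr, hball⟩ := Metric.mem_nhds_iff.1 (inter_mem h1 h2)
  set B := Metric.ball ((1 / 2 : ℝ), ω) r
  have h3 := withDensity_le_of_le hden (E := B) Metric.isOpen_ball.measurableSet
    fun q hq => (hball hq).1.le
  have h4 := hmin B (hball.trans inter_subset_right) Metric.isOpen_ball.measurableSet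
  have hB0 : volume B ≠ 0 := (Metric.measure_ball_pos volume _ hr).ne'
  have hBt : volume B ≠ ⊤ := (Metric.isBounded_ball.measure_lt_top).ne
  have h5 : ε ≤ ENNReal.ofReal ((min ε 1).toReal / 2) :=
    (ENNReal.mul_le_mul_iff_left hB0 hBt).1 (h4.trans h3)
  have h6 : min ε 1 ≤ ENNReal.ofReal ((min ε 1).toReal / 2) := (min_le_left _ _).trans h5
  rw [← ENNReal.ofReal_toReal hε1, ENNReal.toReal_ofReal hpos.le,
    ENNReal.ofReal_le_ofReal_iff (by positivity)] at h6
  linarith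

lemma setLIntegral_snd {F : ℝ → ℝ} {s : Set ℝ}
    (hF : IntegrableOn F (Icc 0 1)) (hF0 : 0 ≤ᵐ[volume.restrict (Icc (0 : ℝ) 1)] F) :
    ∫⁻ p in s ×ˢ Icc (0 : ℝ) 1, ENNReal.ofReal (F p.2) =
      volume s * ENNReal.ofReal (∫ ω in Icc (0 : ℝ) 1, F ω) := by
  rw [ofReal_integral_eq_lintegral_ofReal hF hF0, Measure.volume_eq_prod, ← Measure.prod_restrict]
  have := lintegral_prod_mul (μ := volume.restrict s) (ν := volume.restrict (Icc (0 : ℝ) 1))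
    (f := fun _ => 1) aemeasurable_const hF.aestronglyMeasurable.aemeasurable.ennreal_ofReal
  simpa using this

/-- The strip of width `t / 2` to the right of `x = 1/2`. -/
def strip (t : ℝ) : Set (ℝ × ℝ) := Ioc (1 / 2) (1 / 2 + t / 2) ×ˢ Icc 0 1

lemma measurableSet_strip (t : ℝ) : MeasurableSet (strip t) :=
  measurableSet_Ioc.prod measurableSet_Icc

lemma tendsto_strip_div [IsFiniteMeasure ν]
    (hden : ν = volume.withDensity (fun p => ENNReal.ofReal (h p)))
    {L : NNReal} (hL : LipschitzOnWith L h (Icc (1 / 2) 1 ×ˢ Icc 0 1)) {ε : ℝ} (hε : 0 < ε)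
    (hH : ∀ᵐ ω ∂volume.restrict (Icc (0 : ℝ) 1), ε ≤ h (1 / 2, ω)) :
    Tendsto (fun t => ν.real (strip t) / t) (𝓝[>] 0)
      (𝓝 ((∫ ω in Icc (0 : ℝ) 1, h (1 / 2, ω)) / 2)) := by
  set I := ∫ ω in Icc (0 : ℝ) 1, h (1 / 2, ω)
  have hInt : IntegrableOn (fun ω => h (1 / 2, ω)) (Icc 0 1) := by
    refine ContinuousOn.integrableOn_Icc (hL.continuousOn.comp (by fun_prop) fun ω hω => ?_)
    exact ⟨by constructor <;> norm_num, hω⟩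
  have hvar : ∀ t, 0 < t → t ≤ 1 → ∀ p ∈ strip t, |h p - h (1 / 2, p.2)| ≤ L * t := by
    rintro t ht ht1 p ⟨⟨h1, h2⟩, h3⟩
    have h4 := hL.dist_le_mul p ⟨⟨h1.le, by linarith⟩, h3⟩ (1 / 2, p.2)
      ⟨by constructor <;> norm_num, h3⟩
    have h5 : dist p.1 (1 / 2) ≤ t := by
      rw [Real.dist_eq, abs_of_pos (sub_pos.2 h1)]
      linarith
    rw [Real.dist_eq, Prod.dist_eq, dist_self, max_eq_left dist_nonneg] at h4
    exact h4.trans (by gcongr)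
  have hconst : ∀ c : ℝ, ∫ ω in Icc (0 : ℝ) 1, (h (1 / 2, ω) + c) = I + c := by
    intro c
    rw [integral_add hInt (by simp)]
    simp [I]
  have hnn : ∀ c, 0 ≤ ε + c → 0 ≤ᵐ[volume.restrict (Icc (0 : ℝ) 1)] fun ω => h (1 / 2, ω) + c := by
    intro c hc
    filter_upwards [hH] with ω hω
    simp only [Pi.zero_apply]
    linarith
  have hlint : ∀ t c, 0 ≤ ε + c → ∫⁻ p in strip t, ENNReal.ofReal (h (1 / 2, p.2) + c) =
      ENNReal.ofReal (t / 2) * ENNReal.ofReal (I + c) := by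
    intro t c hc
    rw [strip, setLIntegral_snd (F := fun ω => h (1 / 2, ω) + c) (hInt.add (by simp)) (hnn c hc),
      hconst, Real.volume_Ioc, add_sub_cancel_left]
  have hlint_real : ∀ t c, 0 < t → 0 ≤ ε + c →
      (∫⁻ p in strip t, ENNReal.ofReal (h (1 / 2, p.2) + c)).toReal = t / 2 * (I + c) := by
    intro t c ht hc
    rw [hlint t c hc, ENNReal.toReal_mul, ENNReal.toReal_ofReal (by positivity),
      ENNReal.toReal_ofReal (hconst c ▸ integral_nonneg_of_ae (hnn c hc))]
  have hν : ∀ t, ν (strip t) = ∫⁻ p in strip t, ENNReal.ofReal (h p) := fun t => by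
    rw [hden, withDensity_apply _ (measurableSet_strip t)]
  have hlim : ∀ c : ℝ, Tendsto (fun t : ℝ => (I + c * t) / 2) (𝓝[>] 0) (𝓝 (I / 2)) := fun c => by
    have : Continuous fun t : ℝ => (I + c * t) / 2 := by fun_prop
    simpa using (this.tendsto 0).mono_left nhdsWithin_le_nhds
  have hsmall : ∀ᶠ t : ℝ in 𝓝[>] 0, 0 < t ∧ t ≤ 1 ∧ L * t ≤ ε := by
    have h1 : ∀ᶠ t : ℝ in 𝓝[>] 0, t < min 1 (ε / (L + 1)) :=
      nhdsWithin_le_nhds (gt_mem_nhds (by positivity))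
    filter_upwards [h1, self_mem_nhdsWithin] with t h1 h2
    have h3 : t < ε / (L + 1) := h1.trans_le (min_le_right _ _)
    rw [lt_div_iff₀ (by positivity)] at h3
    rw [mem_Ioi] at h2
    exact ⟨h2, (h1.trans_le (min_le_left _ _)).le, by nlinarith⟩
  refine tendsto_of_tendsto_of_tendsto_of_le_of_le' (hlim (-L)) (hlim L) ?_ ?_
  · filter_upwards [hsmall] with t ⟨ht, ht1, htε⟩
    rw [le_div_iff₀ ht, measureReal_def, hν]
    have h1 := ENNReal.toReal_mono (hν t ▸ measure_ne_top ν _)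
      (setLIntegral_mono' (measurableSet_strip t) fun p hp => ENNReal.ofReal_le_ofReal
        (show h (1 / 2, p.2) + (-(L * t)) ≤ h p by
          linarith [(abs_le.1 (hvar t ht ht1 p hp)).1]))
    rw [hlint_real t _ ht (by linarith)] at h1
    linarith
  · filter_upwards [hsmall] with t ⟨ht, ht1, htε⟩
    rw [div_le_iff₀ ht, measureReal_def, hν]
    have hc : 0 ≤ ε + L * t := by positivity
    have h1 := ENNReal.toReal_mono
      (hlint t _ hc ▸ ENNReal.mul_ne_top ENNReal.ofReal_ne_top ENNReal.ofReal_ne_top)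
      (setLIntegral_mono' (measurableSet_strip t) fun p hp => ENNReal.ofReal_le_ofReal
        (show h p ≤ h (1 / 2, p.2) + L * t by
          linarith [(abs_le.1 (hvar t ht ht1 p hp)).2]))
    rw [hlint_real t _ ht hc] at h1
    linarith

lemma exists_measureReal_prod_le [IsFiniteMeasure ν]
    (hden : ν = volume.withDensity (fun p => ENNReal.ofReal (h p)))
    {L : NNReal} (hL : LipschitzOnWith L h (Icc (1 / 2) 1 ×ˢ Icc 0 1)) :
    ∃ M, 0 ≤ M ∧ ∀ (B : Set ℝ) (r : ℝ), 0 ≤ r → B ⊆ Icc 0 1 → MeasurableSet B →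
      volume B ≤ ENNReal.ofReal r → ν.real (Ioc (1 / 2) 1 ×ˢ B) ≤ M * r := by
  obtain ⟨M, hM⟩ := (isCompact_Icc.prod isCompact_Icc).bddAbove_image hL.continuousOn
  refine ⟨max M 0, le_max_right _ _, fun B r hr hB hBm hBr => ?_⟩
  have h1 := withDensity_le_of_le (c := max M 0) hden
    ((measurableSet_Ioc (a := (1 / 2 : ℝ)) (b := 1)).prod hBm)
    fun p hp => (hM (mem_image_of_mem h ⟨Ioc_subset_Icc_self hp.1, hB hp.2⟩)).trans (le_max_left _ _)
  rw [Measure.volume_eq_prod, Measure.prod_prod, Real.volume_Ioc] at h1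
  have h2 : ν (Ioc (1 / 2) 1 ×ˢ B) ≤ ENNReal.ofReal (max M 0 * r) := by
    rw [ENNReal.ofReal_mul (le_max_right _ _)]
    refine h1.trans ?_
    gcongr
    calc ENNReal.ofReal (1 - 1 / 2) * volume B ≤ 1 * volume B := by
          gcongr
          exact ENNReal.ofReal_le_one.2 (by norm_num)
      _ ≤ _ := by rwa [one_mul]
  exact ENNReal.toReal_le_of_le_ofReal (by positivity) h2

end Density

/-! ### The tail asymptotics -/

lemma tendsto_scaled_bounds {ν : Measure (ℝ × ℝ)} {α D c I M : ℝ} (hα : 0 < α) (hD : 0 < D)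
    (hc : 0 < c) (hstrip : Tendsto (fun t => ν.real (strip t) / t) (𝓝[>] 0) (𝓝 I)) :
    Tendsto (fun n : ℕ => (ν.real (strip ((D * n) ^ (-(1 / α)))) + M * Real.exp (-c * n)) /
      (n : ℝ) ^ (-(1 / α))) atTop (𝓝 (D ^ (-(1 / α)) * I)) := by
  have ht : Tendsto (fun n : ℕ => (D * (n : ℝ)) ^ (-(1 / α))) atTop (𝓝[>] 0) := by
    refine tendsto_nhdsWithin_iff.2 ⟨(tendsto_rpow_neg_atTop (by positivity)).comp
      (tendsto_natCast_atTop_atTop.const_mul_atTop hD), ?_⟩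
    filter_upwards [eventually_ge_atTop 1] with n hn
    have hn' : (0 : ℝ) < n := by exact_mod_cast hn
    exact Real.rpow_pos_of_pos (by positivity) _
  have h1 := ((hstrip.comp ht).const_mul (D ^ (-(1 / α)))).add
    (((tendsto_rpow_mul_exp_neg_mul_atTop_nhds_zero (1 / α) c hc).comp
      tendsto_natCast_atTop_atTop).const_mul M)
  rw [mul_zero, add_zero] at h1
  refine h1.congr' ?_
  filter_upwards [eventually_ge_atTop 1] with n hn
  have hn' : (0 : ℝ) < n := by exact_mod_cast hn
  simp only [Function.comp]
  rw [Real.mul_rpow hD.le hn'.le, Real.rpow_neg hn'.le, Real.rpow_neg hD.le]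
  field_simp

lemma measurableSet_sep_alphaCount_lt (p₁ a : ℝ) (n : ℕ) :
    MeasurableSet {ω ∈ Icc (0 : ℝ) 1 | alphaCount p₁ n ω < a} :=
  measurableSet_Icc.inter (measurableSet_lt (measurable_alphaCount p₁ n) measurable_const)

lemma measurableSet_sep_lt_alphaCount (p₁ a : ℝ) (n : ℕ) :
    MeasurableSet {ω ∈ Icc (0 : ℝ) 1 | a < alphaCount p₁ n ω} :=
  measurableSet_Icc.inter (measurableSet_lt measurable_const (measurable_alphaCount p₁ n))

lemma strip_const_eq {α p₁ : ℝ} (hα : 0 < α) (hp₁ : 0 < p₁) (h : ℝ × ℝ → ℝ) :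
    (α * 2 ^ α * p₁) ^ (-(1 / α)) * ((∫ ω in Icc (0 : ℝ) 1, h (1 / 2, ω)) / 2) =
      Aconst α p₁ h := by
  have h1 : α * 2 ^ α * p₁ = (α * p₁) * 2 ^ α := by ring
  have h2 : α * -(1 / α) = -1 := by field_simp
  rw [Aconst, h1, Real.mul_rpow (by positivity) (by positivity), ← Real.rpow_mul zero_le_two, h2,
    Real.rpow_neg_one]
  ring

/-- Lemma 3.3: `ν(R > n) ∼ A n^{-1/α}`. -/
theorem nu_return_time_tail (α β p₁ : ℝ) (hα : 0 < α) (hαβ : α < β) (hβ : β < 1)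
    (hp₁ : 0 < p₁) (hp₁' : p₁ < 1)
    (ν : Measure (ℝ × ℝ)) (hprob : IsProbabilityMeasure ν)
    (hac : ν ≪ (volume : Measure (ℝ × ℝ)))
    (hsupp : ν ((Icc (0 : ℝ) 1 ×ˢ Icc (0 : ℝ) 1)ᶜ) = 0)
    (hinv : ∀ A : Set (ℝ × ℝ), MeasurableSet A → ν (skewLSV α β p₁ ⁻¹' A) = ν A)
    (h : ℝ × ℝ → ℝ) (hden : ν = volume.withDensity (fun p => ENNReal.ofReal (h p)))
    (hLip : ∀ K : Set (ℝ × ℝ), K ⊆ Ioc (0 : ℝ) 1 ×ˢ Icc (0 : ℝ) 1 → IsCompact K →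
      ∃ L : NNReal, LipschitzOnWith L h K) :
    Tendsto
      (fun n : ℕ =>
        (ν {p : ℝ × ℝ | p ∈ Δ0 ∧ n < retTime α β p₁ p}).toReal /
          (Aconst α p₁ h * (n : ℝ) ^ (-(1 / α))))
      atTop (𝓝 1) := by
  have hβ0 : 0 < β := hα.trans hαβ
  have hα1 : α ≤ 1 := (hαβ.trans hβ).le
  obtain ⟨ε, hε, hH⟩ : ∃ ε, 0 < ε ∧ ∀ ω ∈ Ioo (0 : ℝ) 1, ε ≤ h (1 / 2, ω) := by
    obtain ⟨a, b, c, d, ha, hab, hb, hc, hcd, hd, hV⟩ := exists_minorized hac hsupp hden hLip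
    obtain ⟨a, b, d, ha, hab, hb, hd0, hd, hV⟩ :=
      hV.exists_fibre_zero hα hβ0 hp₁ hp₁' hinv ha hab hb hc hcd hd
    obtain ⟨a, b, ha, hab, hb, hV⟩ := hV.exists_fibre_full hα hp₁ hp₁' hinv ha hab hb hd0 hd
    obtain ⟨a, b, ha, hb, hV⟩ := hV.exists_half hα hp₁ hp₁' hinv ha hab hb
    exact exists_pos_le_density hden hLip ha hb hV
  have hHae : ∀ᵐ ω ∂volume.restrict (Icc (0 : ℝ) 1), ε ≤ h (1 / 2, ω) := by
    rw [← restrict_Ioo_eq_restrict_Icc]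
    exact ae_restrict_of_forall_mem measurableSet_Ioo hH
  obtain ⟨L, hL⟩ := hLip (Icc (1 / 2) 1 ×ˢ Icc 0 1)
    (prod_mono (fun x hx => ⟨lt_of_lt_of_le (by norm_num) hx.1, hx.2⟩) Subset.rfl)
    (isCompact_Icc.prod isCompact_Icc)
  have hstrip := tendsto_strip_div hden hL hε hHae
  obtain ⟨M, hM, hbad⟩ := exists_measureReal_prod_le hden hL
  have hA := strip_const_eq hα hp₁ h
  set I := (∫ ω in Icc (0 : ℝ) 1, h (1 / 2, ω)) / 2 with hI
  set D₀ := α * 2 ^ α * p₁ with hD₀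
  have hD₀pos : 0 < D₀ := by positivity
  have hIpos : 0 < I := by
    have hInt : IntegrableOn (fun ω => h (1 / 2, ω)) (Icc 0 1) := by
      refine ContinuousOn.integrableOn_Icc (hL.continuousOn.comp (by fun_prop) fun ω hω => ?_)
      exact ⟨by constructor <;> norm_num, hω⟩
    have h1 : ∫ _ω in Icc (0 : ℝ) 1, ε ≤ ∫ ω in Icc (0 : ℝ) 1, h (1 / 2, ω) :=
      integral_mono_ae (by simp) hInt hHae
    simp at h1
    simp only [hI, one_div]
    linarith
  have hcont : Tendsto (fun D : ℝ => D ^ (-(1 / α)) * I) (𝓝 D₀) (𝓝 (D₀ ^ (-(1 / α)) * I)) :=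
    (Real.continuousAt_rpow_const _ _ (Or.inl hD₀pos.ne')).mul_const I
  set E : ℕ → Set (ℝ × ℝ) := fun n => {p | p ∈ Δ0 ∧ n < retTime α β p₁ p}
  suffices H : Tendsto (fun n : ℕ => ν.real (E n) / (n : ℝ) ^ (-(1 / α))) atTop
      (𝓝 (D₀ ^ (-(1 / α)) * I)) by
    have h0 : D₀ ^ (-(1 / α)) * I ≠ 0 := by positivity
    have h1 := H.div_const (D₀ ^ (-(1 / α)) * I)
    rw [div_self h0] at h1
    refine h1.congr fun n => ?_
    rw [← hA, div_div, mul_comm ((n : ℝ) ^ _)]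
    rfl
  refine tendsto_order.2 ⟨fun a ha => ?_, fun a ha => ?_⟩
  · obtain ⟨D, haD, hD⟩ := (((hcont.eventually_const_lt ha).filter_mono
      (nhdsWithin_le_nhds (s := Ioi D₀))).and self_mem_nhdsWithin).exists
    obtain ⟨δ, hδ, hδ1, hev⟩ := lt_retTime_of_count hα hα1 hαβ hp₁ hp₁' hD
    have hlim := tendsto_scaled_bounds (M := -M) hα (hD₀pos.trans hD)
      (show 0 < δ ^ 2 / 4 by positivity) hstrip
    filter_upwards [hev, hlim.eventually_const_lt haD] with n hn hlt
    refine hlt.trans_le ?_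
    gcongr
    set B := {ω ∈ Icc (0 : ℝ) 1 | (p₁ + δ) * n < alphaCount p₁ n ω}
    set t := (D * (n : ℝ)) ^ (-(1 / α))
    have hsub : strip t ∩ Δ0 ⊆ E n ∪ Ioc (1 / 2) 1 ×ˢ B := by
      rintro p ⟨hp, hpΔ⟩
      by_cases hpB : p.2 ∈ B
      · exact Or.inr ⟨hpΔ.1, hpB⟩
      · refine Or.inl ⟨hpΔ, hn p hpΔ ?_ ?_⟩
        · by_contra! hcon
          exact hpB ⟨hpΔ.2, hcon⟩
        · linarith [hp.1.2]
    have hstripΔ : ν.real (strip t) ≤ ν.real (strip t ∩ Δ0) := by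
      refine ENNReal.toReal_mono (measure_ne_top _ _) ?_
      rw [← measure_inter_add_sdiff (strip t)
        (measurableSet_Icc.prod measurableSet_Icc : MeasurableSet (Icc (0 : ℝ) 1 ×ˢ Icc (0 : ℝ) 1)),
        measure_mono_null (fun p hp => hp.2 :
          strip t \ Icc (0 : ℝ) 1 ×ˢ Icc (0 : ℝ) 1 ⊆ (Icc (0 : ℝ) 1 ×ˢ Icc (0 : ℝ) 1)ᶜ) hsupp,
        add_zero]
      exact measure_mono fun p hp => ⟨hp.1, ⟨hp.1.1.1, hp.2.1.2⟩, hp.2.2⟩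
    have h1 := (measureReal_mono hsub).trans (measureReal_union_le (μ := ν) _ _)
    have h2 := hbad B _ (Real.exp_pos _).le (sep_subset _ _)
      (measurableSet_sep_lt_alphaCount p₁ _ n) (volume_alphaCount_gt_le hp₁ hp₁' hδ hδ1 n)
    linarith
  · obtain ⟨D, ⟨haD, hDpos⟩, hD⟩ := ((((hcont.eventually_lt_const ha).and
      (lt_mem_nhds hD₀pos)).filter_mono
      (nhdsWithin_le_nhds (s := Iio D₀))).and self_mem_nhdsWithin).exists
    obtain ⟨δ, hδ, hδ1, hev⟩ := fst_le_of_lt_retTime_of_count hα hα1 hαβ hp₁ hp₁' hDpos hD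
    have hlim := tendsto_scaled_bounds (M := M) hα hDpos
      (show 0 < δ ^ 2 / 4 by positivity) hstrip
    filter_upwards [hev, hlim.eventually_lt_const haD] with n hn hlt
    refine lt_of_le_of_lt ?_ hlt
    gcongr
    set B := {ω ∈ Icc (0 : ℝ) 1 | alphaCount p₁ n ω < (p₁ - δ) * n}
    set t := (D * (n : ℝ)) ^ (-(1 / α))
    have hsub : E n ⊆ strip t ∪ Ioc (1 / 2) 1 ×ˢ B := by
      rintro p ⟨hpΔ, hR⟩
      by_cases hpB : p.2 ∈ B
      · exact Or.inr ⟨hpΔ.1, hpB⟩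
      · refine Or.inl ⟨⟨hpΔ.1.1, ?_⟩, hpΔ.2⟩
        have := hn p hpΔ hR (by
          by_contra! hcon
          exact hpB ⟨hpΔ.2, hcon⟩)
        linarith
    have h1 := (measureReal_mono hsub).trans (measureReal_union_le (μ := ν) _ _)
    have h2 := hbad B _ (Real.exp_pos _).le (sep_subset _ _)
      (measurableSet_sep_alphaCount_lt p₁ _ n) (volume_alphaCount_lt_le hp₁ hp₁' hδ hδ1 n)
    linarith
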